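/- arXiv:2605.06751 — 2 statements merged into one kernel-verified Lean document; each statement's English description precedes it below -/
import Mathlib

section
/- For every arbitrarily varying wiretap channel (AVWC) (𝒲,𝒱), the capacity for random encoding codes with average error and strong secrecy equals the capacity for random encoding codes with maximal error and mutual-information (semantic) security: C_{a-str}(𝒲,𝒱) = C_{m-mis}(𝒲,𝒱). -/
open scoped BigOperators

noncomputable section

/-- A probability distribution on a finite type. -/
def IsProbDist {α : Type} [Fintype α] (p : α → ℝ) : Prop :=
  (∀ a, 0 ≤ p a) ∧ (∑ a, p a) = 1

/-- A channel (stochastic matrix) from `α` to `β`. -/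
def IsChannel {α β : Type} [Fintype β] (W : α → β → ℝ) : Prop :=
  ∀ a, IsProbDist (W a)

/-- Output distribution of channel `V` under random encoder `Φ` on message `u`. -/
def Zout {U X Z : Type} [Fintype X] (Φ : U → X → ℝ) (V : X → Z → ℝ) (u : U) (z : Z) : ℝ :=
  ∑ x, Φ u x * V x z

/-- Probability that the decoder `ψ` fails on message `u`. -/
def errProb {U X Y : Type} [Fintype X] [Fintype Y] [DecidableEq U]
    (W : X → Y → ℝ) (Φ : U → X → ℝ) (ψ : Y → U) (u : U) : ℝ :=
  ∑ y, (if ψ y ≠ u then Zout Φ W u y else 0)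

/-- Shannon mutual information (natural logarithm) of the joint law `p u * q u z`. -/
def mutualInfo {U Z : Type} [Fintype U] [Fintype Z] (p : U → ℝ) (q : U → Z → ℝ) : ℝ :=
  ∑ u, ∑ z, p u * q u z * Real.log (q u z / (∑ v, p v * q v z))

/-- A general arbitrarily varying wiretap channel. -/
structure GAVWC where
  X : ℕ → Type
  Y : ℕ → Type
  Z : ℕ → Type
  SW : ℕ → Type
  SV : ℕ → Type
  fX : ∀ n, Fintype (X n)
  fY : ∀ n, Fintype (Y n)
  fZ : ∀ n, Fintype (Z n)
  fSW : ∀ n, Fintype (SW n)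
  fSV : ∀ n, Fintype (SV n)
  neX : ∀ n, Nonempty (X n)
  neY : ∀ n, Nonempty (Y n)
  neZ : ∀ n, Nonempty (Z n)
  neSW : ∀ n, Nonempty (SW n)
  neSV : ∀ n, Nonempty (SV n)
  W : ∀ n, SW n → X n → Y n → ℝ
  V : ∀ n, SV n → X n → Z n → ℝ
  chanW : ∀ n s, @IsChannel (X n) (Y n) (fY n) (W n s)
  chanV : ∀ n s, @IsChannel (X n) (Z n) (fZ n) (V n s)

/-- `R` is achievable with average error and strong secrecy. -/
def GAVWC.achAStr (C : GAVWC) (R : ℝ) : Prop :=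
  0 ≤ R ∧
  ∀ ε > (0:ℝ), ∀ lam > (0:ℝ), ∀ mu > (0:ℝ), ∃ N : ℕ, ∀ n ≥ N,
    letI := C.fX n; letI := C.fY n; letI := C.fZ n
    ∃ (M : ℕ) (Φ : Fin M → C.X n → ℝ) (ψ : C.Y n → Fin M),
      0 < M ∧
      (∀ u, IsProbDist (Φ u)) ∧
      (n : ℝ)⁻¹ * Real.logb 2 M > R - ε ∧
      (∀ s : C.SW n, (∑ u, (M : ℝ)⁻¹ * errProb (C.W n s) Φ ψ u) ≤ lam) ∧
      (∀ s : C.SV n,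
        mutualInfo (fun _ : Fin M => (M : ℝ)⁻¹) (fun u => Zout Φ (C.V n s) u) ≤ mu)

/-- `R` is achievable with maximal error and mutual-information (semantic) security. -/
def GAVWC.achMMis (C : GAVWC) (R : ℝ) : Prop :=
  0 ≤ R ∧
  ∀ ε > (0:ℝ), ∀ lam > (0:ℝ), ∀ mu > (0:ℝ), ∃ N : ℕ, ∀ n ≥ N,
    letI := C.fX n; letI := C.fY n; letI := C.fZ n
    ∃ (M : ℕ) (Φ : Fin M → C.X n → ℝ) (ψ : C.Y n → Fin M),
      0 < M ∧
      (∀ u, IsProbDist (Φ u)) ∧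
      (n : ℝ)⁻¹ * Real.logb 2 M > R - ε ∧
      (∀ s : C.SW n, ∀ u, errProb (C.W n s) Φ ψ u ≤ lam) ∧
      (∀ s : C.SV n, ∀ p : Fin M → ℝ, IsProbDist p →
        mutualInfo p (fun u => Zout Φ (C.V n s) u) ≤ mu)

/-- Capacity for average error and strong secrecy (`0` if no rate is achievable). -/
def GAVWC.CaStr (C : GAVWC) : ℝ := sSup {R | C.achAStr R}

/-- Capacity for maximal error and mutual-information security (`0` if no rate is achievable). -/
def GAVWC.CmMis (C : GAVWC) : ℝ := sSup {R | C.achMMis R}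


/-- The memoryless product of a family of channels is again a channel. -/
lemma prodIsChannel {S X Y : Type} [Fintype Y] (W : S → X → Y → ℝ)
    (hW : ∀ s, IsChannel (W s)) (n : ℕ) (s : Fin n → S) :
    IsChannel (fun (x : Fin n → X) (y : Fin n → Y) => ∏ i, W (s i) (x i) (y i)) := by
  intro x
  constructor
  · intro y
    exact Finset.prod_nonneg fun i _ => (hW (s i) (x i)).1 (y i)
  · have := Finset.prod_univ_sum (fun _ : Fin n => (Finset.univ : Finset Y))
      (fun i yi => W (s i) (x i) yi)
    rw [Fintype.piFinset_univ] at this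
    rw [← this]
    exact Finset.prod_eq_one fun i _ => (hW (s i) (x i)).2

/-- The general arbitrarily varying wiretap channel determined by an arbitrarily varying
wiretap channel (AVWC) with state set `S`, alphabets `X`, `Y`, `Z` and channel families
`W`, `V`: at blocklength `n` the alphabets are the `n`-fold products and the channel sets
consist of the memoryless products `W^n_{sⁿ}`, `V^n_{sⁿ}` over all state sequences `sⁿ`. -/
def AVWC.toGAVWC (S X Y Z : Type) [Fintype S] [Fintype X] [Fintype Y] [Fintype Z]
    [Nonempty S] [Nonempty X] [Nonempty Y] [Nonempty Z]
    (W : S → X → Y → ℝ) (V : S → X → Z → ℝ)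
    (hW : ∀ s, IsChannel (W s)) (hV : ∀ s, IsChannel (V s)) : GAVWC where
  X := fun n => Fin n → X
  Y := fun n => Fin n → Y
  Z := fun n => Fin n → Z
  SW := fun n => Fin n → S
  SV := fun n => Fin n → S
  fX := fun _ => inferInstance
  fY := fun _ => inferInstance
  fZ := fun _ => inferInstance
  fSW := fun _ => inferInstance
  fSV := fun _ => inferInstance
  neX := fun _ => inferInstance
  neY := fun _ => inferInstance
  neZ := fun _ => inferInstance
  neSW := fun _ => inferInstance
  neSV := fun _ => inferInstance
  W := fun n s x y => ∏ i, W (s i) (x i) (y i)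
  V := fun n s x z => ∏ i, V (s i) (x i) (z i)
  chanW := fun n s => prodIsChannel W hW n s
  chanV := fun n s => prodIsChannel V hV n s

/-! ### Random colourings -/

/-- If the sum over all colourings of the exponential moments is small enough, then some colouring
keeps every class sum below its threshold. -/
lemma exists_coloring_sum_lt {ι α : Type} [Fintype ι] [Fintype α] {K : ℕ} (hK : 0 < K)
    (a b : ι → α → ℝ) (T : ι → ℝ) (D : ℝ) (hab : ∀ i u, Real.exp (a i u) - 1 ≤ b i u)
    (hT : ∀ i, (∑ u, b i u) / K - T i ≤ -D) (hD : Fintype.card ι * K * Real.exp (-D) < 1) :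
    ∃ c : α → Fin K, ∀ i k, ∑ u with c u = k, a i u < T i := by
  classical
  have hK' : (0 : ℝ) < K := by exact_mod_cast hK
  have moment : ∀ i k, ∑ c : α → Fin K, Real.exp (∑ u with c u = k, a i u - T i)
      ≤ (K : ℝ) ^ Fintype.card α * Real.exp (-D) := by
    intro i k
    have factor : ∀ c : α → Fin K, Real.exp (∑ u with c u = k, a i u - T i)
        = Real.exp (-T i) * ∏ u, (if c u = k then Real.exp (a i u) else 1) := by
      intro c
      rw [sub_eq_add_neg, add_comm, Real.exp_add, Finset.sum_filter, Real.exp_sum]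
      congr 1
      refine Finset.prod_congr rfl fun u _ => ?_
      split_ifs <;> simp
    have swap : ∑ c : α → Fin K, ∏ u, (if c u = k then Real.exp (a i u) else 1)
        = ∏ u, ∑ j : Fin K, (if j = k then Real.exp (a i u) else 1) := by
      have := Finset.prod_univ_sum (fun _ : α => (Finset.univ : Finset (Fin K)))
        (fun u j => if j = k then Real.exp (a i u) else 1)
      rw [Fintype.piFinset_univ] at this
      exact this.symm
    have single : ∀ u, ∑ j : Fin K, (if j = k then Real.exp (a i u) else 1)
        ≤ K * Real.exp (b i u / K) := by
      intro u
      have : ∀ j : Fin K, (if j = k then Real.exp (a i u) else 1)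
          = 1 + if j = k then Real.exp (a i u) - 1 else 0 := by
        intro j; split_ifs <;> ring
      simp_rw [this, Finset.sum_add_distrib]
      simp only [Finset.sum_const, Finset.card_univ, Fintype.card_fin, nsmul_eq_mul, mul_one,
        Finset.sum_ite_eq', Finset.mem_univ, if_true]
      have h1 := Real.add_one_le_exp (b i u / K)
      have h2 : (K : ℝ) * (b i u / K + 1) = K + b i u := by field_simp; ring
      nlinarith [hab i u, mul_le_mul_of_nonneg_left h1 hK'.le]
    have nonneg : ∀ u, 0 ≤ ∑ j : Fin K, (if j = k then Real.exp (a i u) else 1) := fun u =>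
      Finset.sum_nonneg fun j _ => by split_ifs <;> positivity
    simp_rw [factor]
    rw [← Finset.mul_sum, swap]
    calc _ ≤ Real.exp (-T i) * ∏ u, ((K : ℝ) * Real.exp (b i u / K)) := by
          gcongr with u
          exact single u
      _ = (K : ℝ) ^ Fintype.card α * Real.exp ((∑ u, b i u) / K - T i) := by
          rw [Finset.prod_mul_distrib, ← Real.exp_sum, ← Finset.sum_div, Finset.prod_const,
            Finset.card_univ, sub_eq_add_neg, Real.exp_add]
          ring
      _ ≤ _ := by gcongr; exact hT i
  have total : ∑ c : α → Fin K, ∑ i, ∑ k, Real.exp (∑ u with c u = k, a i u - T i)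
      < ∑ _c : α → Fin K, (1 : ℝ) := by
    rw [Finset.sum_comm]
    simp_rw [Finset.sum_comm (s := (Finset.univ : Finset (α → Fin K)))]
    calc _ ≤ ∑ _i : ι, ∑ _k : Fin K, (K : ℝ) ^ Fintype.card α * Real.exp (-D) :=
          Finset.sum_le_sum fun i _ => Finset.sum_le_sum fun k _ => moment i k
      _ = (K : ℝ) ^ Fintype.card α * (Fintype.card ι * K * Real.exp (-D)) := by
          simp; ring
      _ < (K : ℝ) ^ Fintype.card α * 1 := by gcongr
      _ = _ := by simp
  obtain ⟨c, -, hc⟩ := Finset.exists_lt_of_sum_lt total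
  refine ⟨c, fun i k => ?_⟩
  by_contra! h
  have h1 : (1 : ℝ) ≤ Real.exp (∑ u with c u = k, a i u - T i) :=
    Real.one_le_exp (by linarith)
  have h2 : Real.exp (∑ u with c u = k, a i u - T i)
      ≤ ∑ k, Real.exp (∑ u with c u = k, a i u - T i) :=
    Finset.single_le_sum (f := fun k => Real.exp (∑ u with c u = k, a i u - T i))
      (fun _ _ => (Real.exp_pos _).le) (Finset.mem_univ k)
  have h3 : ∑ k, Real.exp (∑ u with c u = k, a i u - T i)
      ≤ ∑ i, ∑ k, Real.exp (∑ u with c u = k, a i u - T i) :=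
    Finset.single_le_sum (f := fun i => ∑ k, Real.exp (∑ u with c u = k, a i u - T i))
      (fun _ _ => Finset.sum_nonneg fun _ _ => (Real.exp_pos _).le) (Finset.mem_univ i)
  linarith

/-- Finitely many `[0, B]`-valued functions of small mean have simultaneously small means on all
classes of a suitable colouring. -/
lemma exists_coloring_mean_le {ι : Type} [Fintype ι] {M K : ℕ} (hK : 0 < K)
    (h : ι → Fin M → ℝ) {η B : ℝ} (hη : η ≤ 1 / 4) (hB : 1 ≤ B)
    (h0 : ∀ i u, 0 ≤ h i u) (hle : ∀ i u, h i u ≤ B) (hmean : ∀ i, ∑ u, h i u ≤ η * M)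
    (hcount : ((Fintype.card ι : ℝ) + 1) * K * Real.exp (-(η * (M / K) / B)) < 1) :
    ∃ c : Fin M → Fin K, ∀ k, (0 : ℝ) < (Finset.univ.filter (fun u => c u = k)).card ∧
      ∀ i, ((Finset.univ.filter (fun u => c u = k)).card : ℝ)⁻¹ * ∑ u with c u = k, h i u
        ≤ 12 * η := by
  have hK' : (0 : ℝ) < K := by exact_mod_cast hK
  have hB' : 0 < B := by linarith
  have hMK : (0 : ℝ) ≤ M / K := by positivity
  have hexp : Real.exp (-1) ≤ 1 / 2 := by
    rw [Real.exp_neg, inv_eq_one_div]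
    exact one_div_le_one_div_of_le (by norm_num) (by linarith [Real.exp_one_gt_d9])
  obtain ⟨c, hc⟩ := exists_coloring_sum_lt (ι := Option ι) hK
    (fun i u => i.elim (-1) fun i => h i u / B) (fun i u => i.elim (-1 / 2) fun i => 2 * (h i u / B))
    (fun i => i.elim (-(M / K / 4)) fun _ => 3 * η * (M / K) / B) (η * (M / K) / B)
    (by
      rintro (_ | i) u
      · simp only [Option.elim]; linarith
      · have p0 : 0 ≤ h i u / B := div_nonneg (h0 i u) hB'.le
        have p1 : h i u / B ≤ 1 := (div_le_one hB').2 (hle i u)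
        have := Real.abs_exp_sub_one_le (x := h i u / B) (by rwa [abs_of_nonneg p0])
        rw [abs_of_nonneg p0] at this
        exact (le_abs_self _).trans this)
    (by
      rintro (_ | i)
      · simp only [Option.elim, Finset.sum_const, Finset.card_univ, Fintype.card_fin, nsmul_eq_mul]
        have h1 : η * (M / K) / B ≤ M / K / 4 := by
          rw [div_le_iff₀ hB']
          nlinarith [mul_le_mul_of_nonneg_left hB hMK, mul_le_mul_of_nonneg_right hη hMK]
        have h2 : (M : ℝ) * (-1 / 2) / K = -(M / K / 2) := by ring
        rw [h2]; linarith
      · simp only [Option.elim]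
        rw [← Finset.mul_sum, ← Finset.sum_div]
        have h1 : 2 * ((∑ u, h i u) / B) / K ≤ 2 * (η * M / B) / K := by
          gcongr; exact hmean i
        have h2 : 2 * (η * M / B) / K = 2 * (η * (M / K) / B) := by ring
        have h3 : 3 * η * (M / K) / B = 3 * (η * (M / K) / B) := by ring
        rw [h3]; linarith)
    (by rw [Fintype.card_option]; push_cast; exact hcount)
  refine ⟨c, fun k => ?_⟩
  have hcard : (M : ℝ) / K / 4 < (Finset.univ.filter (fun u => c u = k)).card := by
    have := hc none k
    simp only [Option.elim, Finset.sum_const, nsmul_eq_mul] at this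
    linarith
  have hpos : (0 : ℝ) < (Finset.univ.filter (fun u => c u = k)).card := by linarith
  refine ⟨hpos, fun i => ?_⟩
  have hsum := hc (some i) k
  simp only [Option.elim] at hsum
  rw [← Finset.sum_div, div_lt_div_iff_of_pos_right hB'] at hsum
  have hs0 : 0 ≤ ∑ u with c u = k, h i u := Finset.sum_nonneg fun u _ => h0 i u
  rw [inv_mul_le_iff₀ hpos]
  rcases le_or_gt 0 η with hη0 | hη0
  · nlinarith
  · nlinarith

/-! ### Relative entropy on finite types -/

/-- Relative entropy (natural logarithm) on a finite type. -/
def relEnt {Z : Type} [Fintype Z] (q r : Z → ℝ) : ℝ := ∑ z, q z * Real.log (q z / r z)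

/-- The Gibbs inequality, in the form of a change of the second argument. -/
lemma sum_mul_log_div_le_relEnt {Z : Type} [Fintype Z] {q r Q : Z → ℝ} (hq : IsProbDist q)
    (hr : IsProbDist r) (hqr : ∀ z, 0 < q z → 0 < r z) (hqQ : ∀ z, 0 < q z → 0 < Q z) :
    ∑ z, q z * Real.log (r z / Q z) ≤ relEnt q Q := by
  have key : ∀ z, q z * Real.log (r z / Q z) ≤ q z * Real.log (q z / Q z) + (r z - q z) := by
    intro z
    rcases (hq.1 z).eq_or_lt with h | h
    · simpa [← h] using hr.1 z
    · have h1 := hqr z h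
      have h2 := hqQ z h
      have := Real.log_le_sub_one_of_pos (div_pos h1 h)
      rw [Real.log_div h1.ne' h.ne'] at this
      rw [Real.log_div h1.ne' h2.ne', Real.log_div h.ne' h2.ne']
      have h3 : q z * (r z / q z - 1) = r z - q z := by field_simp
      nlinarith [mul_le_mul_of_nonneg_left this h.le]
  calc _ ≤ ∑ z, (q z * Real.log (q z / Q z) + (r z - q z)) := Finset.sum_le_sum fun z _ => key z
    _ = relEnt q Q := by
      rw [Finset.sum_add_distrib, Finset.sum_sub_distrib, hr.2, hq.2, relEnt]; ring

lemma relEnt_nonneg {Z : Type} [Fintype Z] {q Q : Z → ℝ} (hq : IsProbDist q)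
    (hQ : IsProbDist Q) (hqQ : ∀ z, 0 < q z → 0 < Q z) : 0 ≤ relEnt q Q := by
  refine le_trans (Finset.sum_nonneg fun z _ => ?_) (sum_mul_log_div_le_relEnt hq hQ hqQ hqQ)
  rcases eq_or_ne (Q z) 0 with h | h <;> simp [h]

lemma relEnt_le_log {Z : Type} [Fintype Z] {q Q : Z → ℝ} (hq : IsProbDist q)
    {M : ℝ} (hqQ : ∀ z, q z ≤ M * Q z) (hQ : ∀ z, 0 < q z → 0 < Q z) :
    relEnt q Q ≤ Real.log M := by
  calc relEnt q Q ≤ ∑ z, q z * Real.log M := by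
        refine Finset.sum_le_sum fun z _ => ?_
        rcases (hq.1 z).eq_or_lt with h | h
        · simp [← h]
        · have h2 := hQ z h
          have : q z / Q z ≤ M := (div_le_iff₀ h2).2 (hqQ z)
          gcongr
    _ = Real.log M := by rw [← Finset.sum_mul, hq.2, one_mul]

/-- Convexity of the relative entropy in its first argument. -/
lemma relEnt_mix_le {α Z : Type} [Fintype Z] {q : α → Z → ℝ} {r Q : Z → ℝ} (s : Finset α)
    {w : ℝ} (hw : 0 < w) (hq : ∀ u ∈ s, IsProbDist (q u)) (hr : IsProbDist r)
    (hmix : ∀ z, r z = w * ∑ u ∈ s, q u z) (hQ : ∀ u ∈ s, ∀ z, 0 < q u z → 0 < Q z) :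
    relEnt r Q ≤ w * ∑ u ∈ s, relEnt (q u) Q := by
  calc relEnt r Q = w * ∑ u ∈ s, ∑ z, q u z * Real.log (r z / Q z) := by
        rw [relEnt, Finset.sum_comm, Finset.mul_sum]
        refine Finset.sum_congr rfl fun z _ => ?_
        rw [← Finset.sum_mul, ← mul_assoc, ← hmix]
    _ ≤ _ := by
        gcongr with u hu
        refine sum_mul_log_div_le_relEnt (hq u hu) hr (fun z hz => ?_) (hQ u hu)
        rw [hmix]
        exact mul_pos hw (hz.trans_le
          (Finset.single_le_sum (f := fun u => q u z) (fun v hv => (hq v hv).1 z) hu))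

lemma isProbDist_mix {α Z : Type} [Fintype α] [Fintype Z] {p : α → ℝ} {q : α → Z → ℝ}
    (hp : IsProbDist p) (hq : ∀ u, IsProbDist (q u)) : IsProbDist fun z => ∑ u, p u * q u z := by
  refine ⟨fun z => Finset.sum_nonneg fun u _ => mul_nonneg (hp.1 u) ((hq u).1 z), ?_⟩
  rw [Finset.sum_comm]
  simp_rw [← Finset.mul_sum, (hq _).2, mul_one, hp.2]

/-- Mutual information is at most the largest relative entropy to a fixed output law. -/
lemma mutualInfo_le_of_relEnt_le {U Z : Type} [Fintype U] [Fintype Z] {p : U → ℝ}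
    {q : U → Z → ℝ} {Q : Z → ℝ} {D : ℝ} (hp : IsProbDist p) (hq : ∀ u, IsProbDist (q u))
    (hQ : IsProbDist Q) (hqQ : ∀ u z, 0 < q u z → 0 < Q z) (hD : ∀ u, relEnt (q u) Q ≤ D) :
    mutualInfo p q ≤ D := by
  set R : Z → ℝ := fun z => ∑ v, p v * q v z
  have hRd : IsProbDist R := isProbDist_mix hp hq
  have hRQ : ∀ z, 0 < R z → 0 < Q z := by
    intro z hz
    obtain ⟨u, -, hu⟩ := Finset.exists_lt_of_sum_lt (s := Finset.univ) (f := fun _ : U => (0 : ℝ))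
      (g := fun u => p u * q u z) (by simpa using hz)
    exact hqQ u z (pos_of_mul_pos_right hu (hp.1 u))
  have split : ∀ u z, p u * q u z * Real.log (q u z / R z)
      = p u * (q u z * Real.log (q u z / Q z)) - p u * q u z * Real.log (R z / Q z) := by
    intro u z
    rcases ((hq u).1 z).eq_or_lt with h | h
    · simp [← h]
    rcases (hp.1 u).eq_or_lt with h' | h'
    · simp [← h']
    have h1 := hqQ u z h
    have h2 : 0 < R z := (mul_pos h' h).trans_le (Finset.single_le_sum
      (f := fun v => p v * q v z) (fun v _ => mul_nonneg (hp.1 v) ((hq v).1 z)) (Finset.mem_univ u))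
    rw [Real.log_div h.ne' h2.ne', Real.log_div h.ne' h1.ne', Real.log_div h2.ne' h1.ne']
    ring
  calc mutualInfo p q = ∑ u, p u * relEnt (q u) Q - relEnt R Q := by
        rw [mutualInfo]
        simp_rw [relEnt]
        change ∑ u, ∑ z, p u * q u z * Real.log (q u z / R z) = _
        simp_rw [split, Finset.sum_sub_distrib, Finset.mul_sum]
        congr 1
        rw [Finset.sum_comm]
        exact Finset.sum_congr rfl fun z _ => (Finset.sum_mul _ _ _).symm
    _ ≤ ∑ u, p u * relEnt (q u) Q := by linarith [relEnt_nonneg hRd hQ hRQ]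
    _ ≤ ∑ u, p u * D := by
        gcongr with u
        · exact hp.1 u
        · exact hD u
    _ = D := by rw [← Finset.sum_mul, hp.2, one_mul]

/-! ### Grouping the messages of a code -/

lemma Zout_isProbDist {U X Z : Type} [Fintype X] [Fintype Z] {Φ : U → X → ℝ} {V : X → Z → ℝ}
    (hΦ : ∀ u, IsProbDist (Φ u)) (hV : IsChannel V) (u : U) : IsProbDist (Zout Φ V u) :=
  isProbDist_mix (hΦ u) hV

lemma Zout_groupMean {U U' X Z : Type} [Fintype X] (Φ : U → X → ℝ) (V : X → Z → ℝ)
    (s : U' → Finset U) (w : U' → ℝ) (k : U') (z : Z) :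
    Zout (fun k x => w k * ∑ u ∈ s k, Φ u x) V k z = w k * ∑ u ∈ s k, Zout Φ V u z := by
  simp only [Zout]
  rw [Finset.sum_comm, Finset.mul_sum]
  refine Finset.sum_congr rfl fun x _ => ?_
  rw [mul_assoc, Finset.sum_mul]

lemma errProb_nonneg {U X Y : Type} [Fintype X] [Fintype Y] [DecidableEq U] {Φ : U → X → ℝ}
    {W : X → Y → ℝ} (hΦ : ∀ u, IsProbDist (Φ u)) (hW : IsChannel W) (ψ : Y → U) (u : U) :
    0 ≤ errProb W Φ ψ u :=
  Finset.sum_nonneg fun y _ => by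
    split_ifs
    · exact (Zout_isProbDist hΦ hW u).1 y
    · exact le_rfl

lemma errProb_le_one {U X Y : Type} [Fintype X] [Fintype Y] [DecidableEq U] {Φ : U → X → ℝ}
    {W : X → Y → ℝ} (hΦ : ∀ u, IsProbDist (Φ u)) (hW : IsChannel W) (ψ : Y → U) (u : U) :
    errProb W Φ ψ u ≤ 1 := by
  rw [← (Zout_isProbDist hΦ hW u).2]
  refine Finset.sum_le_sum fun y _ => ?_
  split_ifs
  · exact le_rfl
  · exact (Zout_isProbDist hΦ hW u).1 y

/-- The number of messages of a code of average error at most `1 / 2` is at most twice the number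
of channel outputs. -/
lemma card_le_two_mul_of_avg_errProb_le {X Y : Type} [Fintype X] [Fintype Y] {M : ℕ} (hM : 0 < M)
    {Φ : Fin M → X → ℝ} {W : X → Y → ℝ} (hΦ : ∀ u, IsProbDist (Φ u)) (hW : IsChannel W)
    (ψ : Y → Fin M) (h : ∑ u, (M : ℝ)⁻¹ * errProb W Φ ψ u ≤ 1 / 2) :
    (M : ℝ) ≤ 2 * Fintype.card Y := by
  have hM' : (0 : ℝ) < M := by exact_mod_cast hM
  rw [← Finset.mul_sum, inv_mul_le_iff₀ hM'] at h
  have correct : ∀ u, 1 - errProb W Φ ψ u ≤ ∑ y, if ψ y = u then 1 else 0 := by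
    intro u
    have hz := Zout_isProbDist hΦ hW u
    have total : 1 - errProb W Φ ψ u
        = ∑ y, (Zout Φ W u y - if ψ y ≠ u then Zout Φ W u y else 0) := by
      rw [Finset.sum_sub_distrib, hz.2, errProb]
    rw [total]
    refine Finset.sum_le_sum fun y _ => ?_
    have : Zout Φ W u y ≤ 1 := by
      rw [← hz.2]
      exact Finset.single_le_sum (f := Zout Φ W u) (fun y _ => hz.1 y) (Finset.mem_univ y)
    by_cases hy : ψ y = u
    · simpa [hy] using this
    · simp [hy]
  have := Finset.sum_le_sum fun u (_ : u ∈ Finset.univ) => correct u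
  rw [Finset.sum_comm] at this
  simp at this
  linarith

/-- From a code with small average error and small leakage for uniform messages, a random grouping
of the messages yields a code with small maximal error and small leakage for all message laws. -/
lemma exists_grouped_code {X Y Z SW SV : Type} [Fintype X] [Fintype Y] [Fintype Z] [Fintype SW]
    [Fintype SV] {W : SW → X → Y → ℝ} {V : SV → X → Z → ℝ} (hW : ∀ s, IsChannel (W s))
    (hV : ∀ s, IsChannel (V s)) {M K : ℕ} (hM : 0 < M) (hK : 0 < K) {Φ : Fin M → X → ℝ}
    (hΦ : ∀ u, IsProbDist (Φ u)) (ψ : Y → Fin M) {η B : ℝ} (hη : η ≤ 1 / 4) (hB : 1 ≤ B)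
    (hMB : Real.log M ≤ B)
    (herr : ∀ s, ∑ u, (M : ℝ)⁻¹ * errProb (W s) Φ ψ u ≤ η)
    (hleak : ∀ s, mutualInfo (fun _ : Fin M => (M : ℝ)⁻¹) (fun u => Zout Φ (V s) u) ≤ η)
    (hcount : ((Fintype.card SW + Fintype.card SV : ℝ) + 1) * K
      * Real.exp (-(η * (M / K) / B)) < 1) :
    ∃ (Φ' : Fin K → X → ℝ) (ψ' : Y → Fin K), (∀ k, IsProbDist (Φ' k)) ∧
      (∀ s k, errProb (W s) Φ' ψ' k ≤ 12 * η) ∧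
      ∀ s, ∀ p : Fin K → ℝ, IsProbDist p →
        mutualInfo p (fun k => Zout Φ' (V s) k) ≤ 12 * η := by
  have hM' : (0 : ℝ) < M := by exact_mod_cast hM
  have hunif : IsProbDist fun _ : Fin M => (M : ℝ)⁻¹ :=
    ⟨fun _ => by positivity, by simp [hM'.ne']⟩
  set Q : SV → Z → ℝ := fun s z => ∑ u, (M : ℝ)⁻¹ * Zout Φ (V s) u z
  have hq : ∀ s u, IsProbDist (Zout Φ (V s) u) := fun s u => Zout_isProbDist hΦ (hV s) u
  have hQ : ∀ s, IsProbDist (Q s) := fun s => isProbDist_mix hunif (hq s)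
  have hqQ : ∀ s u z, Zout Φ (V s) u z ≤ M * Q s z := by
    intro s u z
    change _ ≤ M * ∑ u, (M : ℝ)⁻¹ * Zout Φ (V s) u z
    rw [← Finset.mul_sum, ← mul_assoc, mul_inv_cancel₀ hM'.ne', one_mul]
    exact Finset.single_le_sum (f := fun u => Zout Φ (V s) u z) (fun v _ => (hq s v).1 z)
      (Finset.mem_univ u)
  have hpos : ∀ s u z, 0 < Zout Φ (V s) u z → 0 < Q s z := fun s u z hz =>
    pos_of_mul_pos_right (hz.trans_le (hqQ s u z)) hM'.le
  obtain ⟨c, hc⟩ := exists_coloring_mean_le (ι := SW ⊕ SV) hK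
    (Sum.elim (fun s u => errProb (W s) Φ ψ u) fun s u => relEnt (Zout Φ (V s) u) (Q s))
    hη hB
    (by
      rintro (s | s) u
      · exact errProb_nonneg hΦ (hW s) ψ u
      · exact relEnt_nonneg (hq s u) (hQ s) (hpos s u))
    (by
      rintro (s | s) u
      · exact (errProb_le_one hΦ (hW s) ψ u).trans hB
      · exact (relEnt_le_log (hq s u) (hqQ s u) (hpos s u)).trans hMB)
    (by
      rintro (s | s)
      · have := herr s
        rw [← Finset.mul_sum, inv_mul_le_iff₀ hM'] at this
        simpa [mul_comm] using this
      · have h1 : ∑ u, relEnt (Zout Φ (V s) u) (Q s)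
            = M * mutualInfo (fun _ : Fin M => (M : ℝ)⁻¹) (fun u => Zout Φ (V s) u) := by
          simp only [mutualInfo, relEnt, Finset.mul_sum]
          refine Finset.sum_congr rfl fun u _ => Finset.sum_congr rfl fun z _ => ?_
          rw [← mul_assoc, ← mul_assoc, mul_inv_cancel₀ hM'.ne', one_mul]
        simp only [Sum.elim_inr]
        rw [h1, mul_comm η]
        gcongr
        exact hleak s)
    (by rw [Fintype.card_sum]; push_cast; exact hcount)
  set G : Fin K → Finset (Fin M) := fun k => Finset.univ.filter fun u => c u = k
  set w : Fin K → ℝ := fun k => ((G k).card : ℝ)⁻¹ with hw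
  have hw0 : ∀ k, 0 < w k := fun k => inv_pos.2 (hc k).1
  have hΦ' : ∀ k, IsProbDist fun x => w k * ∑ u ∈ G k, Φ u x := by
    intro k
    refine ⟨fun x => mul_nonneg (hw0 k).le (Finset.sum_nonneg fun u _ => (hΦ u).1 x), ?_⟩
    rw [← Finset.mul_sum, Finset.sum_comm]
    simp only [(hΦ _).2, Finset.sum_const, nsmul_eq_mul, mul_one, hw]
    exact inv_mul_cancel₀ (hc k).1.ne'
  refine ⟨fun k x => w k * ∑ u ∈ G k, Φ u x, fun y => c (ψ y), hΦ', fun s k => ?_,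
    fun s p hp => ?_⟩
  · refine le_trans ?_ ((hc k).2 (Sum.inl s))
    simp only [Sum.elim_inl, errProb, Zout_groupMean]
    rw [Finset.sum_comm, Finset.mul_sum]
    refine Finset.sum_le_sum fun y _ => ?_
    split_ifs with hy
    · gcongr with u hu
      rw [if_pos]
      rintro rfl
      exact hy (Finset.mem_filter.1 hu).2
    · refine mul_nonneg (hw0 k).le (Finset.sum_nonneg fun u _ => ?_)
      split_ifs
      · exact (Zout_isProbDist hΦ (hW s) u).1 y
      · exact le_rfl
  · refine mutualInfo_le_of_relEnt_le hp (Zout_isProbDist hΦ' (hV s)) (hQ s) (fun k z hz => ?_)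
      fun k => ?_
    · rw [Zout_groupMean] at hz
      obtain ⟨u, -, hu⟩ := Finset.exists_lt_of_sum_lt (s := G k) (f := fun _ => (0 : ℝ))
        (g := fun u => Zout Φ (V s) u z) (by simpa using pos_of_mul_pos_right hz (hw0 k).le)
      exact hpos s u z hu
    · exact (relEnt_mix_le (G k) (hw0 k) (fun u _ => hq s u) (Zout_isProbDist hΦ' (hV s) k)
        (Zout_groupMean Φ (V s) G w k) fun u _ => hpos s u).trans ((hc k).2 (Sum.inr s))

/-! ### Comparison of the achievable rates -/

lemma GAVWC.achAStr_of_achMMis {C : GAVWC} {R : ℝ} (h : C.achMMis R) : C.achAStr R := by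
  refine ⟨h.1, fun ε hε lam hlam mu hmu => ?_⟩
  obtain ⟨N, hN⟩ := h.2 ε hε lam hlam mu hmu
  refine ⟨N, fun n hn => ?_⟩
  obtain ⟨M, Φ, ψ, hM, hΦ, hrate, herr, hleak⟩ := hN n hn
  have hM' : (M : ℝ) ≠ 0 := by exact_mod_cast hM.ne'
  refine ⟨M, Φ, ψ, hM, hΦ, hrate, fun s => ?_, fun s => hleak s _ ⟨fun _ => by positivity, ?_⟩⟩
  · let := C.fX n; let := C.fY n
    calc _ ≤ ∑ _u : Fin M, (M : ℝ)⁻¹ * lam := by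
          gcongr with u
          exact herr s u
      _ = lam := by simp [hM']
  · simp [hM']

lemma GAVWC.exists_trivial_code (C : GAVWC) {lam mu : ℝ} (hlam : 0 < lam) (hmu : 0 < mu) (n : ℕ) :
    letI := C.fX n; letI := C.fY n; letI := C.fZ n
    ∃ (Φ : Fin 1 → C.X n → ℝ) (ψ : C.Y n → Fin 1),
      (∀ u, IsProbDist (Φ u)) ∧
      (∀ s : C.SW n, ∀ u, errProb (C.W n s) Φ ψ u ≤ lam) ∧
      (∀ s : C.SV n, ∀ p : Fin 1 → ℝ, IsProbDist p →
        mutualInfo p (fun u => Zout Φ (C.V n s) u) ≤ mu) := by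
  classical
  let := C.fX n; let := C.fY n; let := C.fZ n
  obtain ⟨x⟩ := C.neX n
  refine ⟨fun _ => Pi.single x 1, fun _ => 0, fun u => ⟨fun a => ?_, by simp⟩, fun s u => ?_,
    fun s p hp => ?_⟩
  · by_cases h : a = x
    · subst h; simp
    · simp [h]
  · simp [errProb, Subsingleton.elim u 0, hlam.le]
  · have hp1 : p 0 = 1 := by simpa using hp.2
    refine le_of_eq_of_le ?_ hmu.le
    simp only [mutualInfo, Fin.sum_univ_one, hp1, one_mul, Fin.isValue]
    refine Finset.sum_eq_zero fun z _ => ?_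
    rcases eq_or_ne (Zout (fun _ : Fin 1 => (Pi.single x 1 : C.X n → ℝ)) (C.V n s) 0 z) 0 with h | h
    · rw [h, zero_mul]
    · rw [div_self h, Real.log_one, mul_zero]

/-- If the numbers of states and outputs grow at most exponentially with the blocklength, then
average error and strong secrecy can be upgraded to maximal error and semantic security. -/
lemma GAVWC.achMMis_of_achAStr {C : GAVWC} {A : ℝ} (hA : 1 ≤ A)
    (hSW : ∀ n, (@Fintype.card (C.SW n) (C.fSW n) : ℝ) ≤ A ^ n)
    (hSV : ∀ n, (@Fintype.card (C.SV n) (C.fSV n) : ℝ) ≤ A ^ n)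
    (hY : ∀ n, (@Fintype.card (C.Y n) (C.fY n) : ℝ) ≤ A ^ n) {R : ℝ} (h : C.achAStr R) :
    C.achMMis R := by
  refine ⟨h.1, fun ε hε lam hlam mu hmu => ?_⟩
  have hA0 : 0 < A := by linarith
  set η : ℝ := min (1 / 4) (min (lam / 12) (mu / 12))
  have hη0 : 0 < η := by positivity
  have hη4 : η ≤ 1 / 4 := min_le_left _ _
  have hηlam : 12 * η ≤ lam := by
    linarith [(min_le_right (1 / 4) (min (lam / 12) (mu / 12))).trans (min_le_left _ _)]
  have hημu : 12 * η ≤ mu := by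
    linarith [(min_le_right (1 / 4) (min (lam / 12) (mu / 12))).trans (min_le_right _ _)]
  set a : ℝ := Real.log A with ha
  have ha0 : 0 ≤ a := Real.log_nonneg hA
  obtain ⟨N₁, hN₁⟩ := h.2 (ε / 2) (by positivity) η hη0 η hη0
  have hgrow : ∀ᶠ n : ℕ in Filter.atTop, Real.logb 2 (2 * (n : ℝ) ^ 3) < n * (ε / 2) := by
    have h1 : Filter.Tendsto (fun n : ℕ => Real.log n / (n : ℝ)) Filter.atTop (nhds 0) :=
      (Real.isLittleO_log_id_atTop.tendsto_div_nhds_zero).comp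
        (tendsto_natCast_atTop_atTop (R := ℝ))
    have h2 : Filter.Tendsto (fun n : ℕ => Real.log 2 / (n : ℝ)) Filter.atTop (nhds 0) :=
      tendsto_const_div_atTop_nhds_zero_nat _
    have h3 := (h2.add (h1.const_mul 3)).div_const (Real.log 2)
    simp only [mul_zero, add_zero, zero_div] at h3
    filter_upwards [h3.eventually_lt_const (half_pos hε), Filter.eventually_ge_atTop 1]
      with n hn hn1
    have hn0 : (0 : ℝ) < n := by exact_mod_cast hn1
    rw [Real.logb, Real.log_mul (by norm_num) (by positivity), Real.log_pow]
    push_cast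
    rw [← div_lt_iff₀' hn0]
    convert hn using 1
    field_simp
  obtain ⟨N₂, hN₂⟩ := Filter.eventually_atTop.1 hgrow
  obtain ⟨N₃, hN₃⟩ := exists_nat_gt (2 * (1 + a) * (2 + a) / η)
  refine ⟨max (max N₁ N₂) (max N₃ 1), fun n hn => ?_⟩
  simp only [ge_iff_le, max_le_iff] at hn
  obtain ⟨⟨hn1, hn2⟩, hn3, hn0⟩ := hn
  have hnpos : (0 : ℝ) < n := by exact_mod_cast hn0
  have hnone : (1 : ℝ) ≤ n := by exact_mod_cast hn0
  by_cases hR : R < ε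
  · obtain ⟨Φ, ψ, hΦ, herr, hleak⟩ := C.exists_trivial_code hlam hmu n
    refine ⟨1, Φ, ψ, one_pos, hΦ, ?_, herr, hleak⟩
    simp; linarith
  push Not at hR
  let := C.fX n; let := C.fY n; let := C.fZ n; let := C.fSW n; let := C.fSV n
  obtain ⟨M, Φ, ψ, hM, hΦ, hrate, herr, hleak⟩ := hN₁ n hn1
  have hM' : (0 : ℝ) < M := by exact_mod_cast hM
  have hrate' : n * (R - ε / 2) < Real.logb 2 M := by
    rwa [gt_iff_lt, lt_inv_mul_iff₀ hnpos] at hrate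
  have hML : 2 * (n : ℝ) ^ 3 < M := by
    rw [← Real.logb_lt_logb_iff one_lt_two (by positivity) hM']
    refine (hN₂ n hn2).trans (lt_of_le_of_lt ?_ hrate')
    gcongr; linarith
  obtain ⟨s₀⟩ := C.neSW n
  have hMA : (M : ℝ) ≤ 2 * A ^ n := by
    have := card_le_two_mul_of_avg_errProb_le hM hΦ (C.chanW n s₀) ψ ((herr s₀).trans (by linarith))
    linarith [hY n]
  have hlog2 : Real.log 2 ≤ 1 := by linarith [Real.log_two_lt_d9]
  have hMB : Real.log M ≤ n * (2 + a) := by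
    calc Real.log M ≤ Real.log (2 * A ^ n) := Real.log_le_log hM' hMA
      _ = Real.log 2 + n * a := by
        rw [Real.log_mul (by norm_num) (by positivity), Real.log_pow]
      _ ≤ n * (2 + a) := by nlinarith
  set K : ℕ := M / n ^ 3
  have hn3pos : 0 < n ^ 3 := by positivity
  have hKM : (K : ℝ) * (n : ℝ) ^ 3 ≤ M := by exact_mod_cast Nat.div_mul_le_self M (n ^ 3)
  have hMK : (M : ℝ) < (K + 1) * (n : ℝ) ^ 3 := by
    have := Nat.lt_mul_div_succ M hn3pos
    rw [mul_comm] at this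
    exact_mod_cast this
  have hKbig : (M : ℝ) / (2 * (n : ℝ) ^ 3) < K := by
    rw [div_lt_iff₀ (by positivity)]
    linarith
  have hKpos' : (0 : ℝ) < K := lt_trans (by positivity) hKbig
  have hKpos : 0 < K := by exact_mod_cast hKpos'
  have hKleM : (K : ℝ) ≤ M := by exact_mod_cast Nat.div_le_self M (n ^ 3)
  have hlarge : 2 * (1 + a) * (2 + a) < η * n := by
    have : (N₃ : ℝ) ≤ n := by exact_mod_cast hn3
    rw [div_lt_iff₀ hη0] at hN₃
    nlinarith
  have hexponent : 2 * n * (1 + a) < η * (M / K) / (n * (2 + a)) := by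
    rw [lt_div_iff₀ (by positivity)]
    have h1 : (n : ℝ) ^ 3 ≤ M / K := by rw [le_div_iff₀ hKpos']; linarith
    have h2 : (n : ℝ) ^ 2 * (2 * (1 + a) * (2 + a)) < (n : ℝ) ^ 2 * (η * n) := by gcongr
    nlinarith [mul_le_mul_of_nonneg_left h1 hη0.le]
  have hcount : ((Fintype.card (C.SW n) + Fintype.card (C.SV n) : ℝ) + 1) * K
      * Real.exp (-(η * (M / K) / (n * (2 + a)))) < 1 := by
    have hAn : 1 ≤ A ^ n := one_le_pow₀ hA
    have hAexp : A ^ n = Real.exp (n * a) := by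
      rw [mul_comm, Real.exp_mul, ha, Real.exp_log hA0, Real.rpow_natCast]
    have hsix : (6 : ℝ) < Real.exp (2 * n) := by
      calc (6 : ℝ) < Real.exp 1 * Real.exp 1 := by nlinarith [Real.exp_one_gt_d9]
        _ = Real.exp 2 := by rw [← Real.exp_add]; norm_num
        _ ≤ _ := Real.exp_le_exp.2 (by linarith)
    calc _ ≤ (3 * A ^ n) * (2 * A ^ n) * Real.exp (-(η * (M / K) / (n * (2 + a)))) := by
          gcongr
          · linarith [hSW n, hSV n]
          · linarith
      _ = 6 * (Real.exp (n * a) * Real.exp (n * a)) *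
            Real.exp (-(η * (M / K) / (n * (2 + a)))) := by rw [← hAexp]; ring
      _ < Real.exp (2 * n) * (Real.exp (n * a) * Real.exp (n * a)) *
            Real.exp (-(η * (M / K) / (n * (2 + a)))) := by gcongr
      _ = Real.exp (2 * n * (1 + a) - η * (M / K) / (n * (2 + a))) := by
          rw [← Real.exp_add, ← Real.exp_add, ← Real.exp_add]; congr 1; ring
      _ < 1 := Real.exp_lt_one_iff.2 (by linarith)
  obtain ⟨Φ', ψ', hΦ', herr', hleak'⟩ := exists_grouped_code (C.chanW n) (C.chanV n) hM hKpos hΦ ψ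
    hη4 (B := n * (2 + a)) (by nlinarith) hMB herr hleak hcount
  refine ⟨K, Φ', ψ', hKpos, hΦ', ?_, fun s k => (herr' s k).trans hηlam,
    fun s p hp => (hleak' s p hp).trans hημu⟩
  rw [gt_iff_lt, lt_inv_mul_iff₀ hnpos]
  calc n * (R - ε) = n * (R - ε / 2) - n * (ε / 2) := by ring
    _ < Real.logb 2 M - Real.logb 2 (2 * (n : ℝ) ^ 3) := sub_lt_sub hrate' (hN₂ n hn2)
    _ = Real.logb 2 (M / (2 * (n : ℝ) ^ 3)) :=
        (Real.logb_div hM'.ne' (by positivity)).symm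
    _ ≤ Real.logb 2 K := Real.logb_le_logb_of_le one_lt_two (by positivity) hKbig.le

/-- For every arbitrarily varying wiretap channel `(𝒲,𝒱)`, the capacity
for random encoding codes with average error and strong secrecy equals the capacity for
random encoding codes with maximal error and mutual-information (semantic) security:
`C_{a-str}(𝒲,𝒱) = C_{m-mis}(𝒲,𝒱)`. -/
theorem avwc_CaStr_eq_CmMis (S X Y Z : Type)
    [Fintype S] [Fintype X] [Fintype Y] [Fintype Z]
    [Nonempty S] [Nonempty X] [Nonempty Y] [Nonempty Z]
    (W : S → X → Y → ℝ) (V : S → X → Z → ℝ)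
    (hW : ∀ s, IsChannel (W s)) (hV : ∀ s, IsChannel (V s)) :
    (AVWC.toGAVWC S X Y Z W V hW hV).CaStr = (AVWC.toGAVWC S X Y Z W V hW hV).CmMis := by

  have hS : (1 : ℝ) ≤ Fintype.card S := by exact_mod_cast Fintype.card_pos
  have hY : (1 : ℝ) ≤ Fintype.card Y := by exact_mod_cast Fintype.card_pos
  have hA : (1 : ℝ) ≤ max (Fintype.card S : ℝ) (Fintype.card Y) := hS.trans (le_max_left _ _)
  have hcardS : ∀ n : ℕ, (Fintype.card (Fin n → S) : ℝ)
      ≤ (max (Fintype.card S : ℝ) (Fintype.card Y)) ^ n := by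
    intro n
    rw [Fintype.card_fun, Fintype.card_fin]
    push_cast
    gcongr
    exact le_max_left _ _
  have hcardY : ∀ n : ℕ, (Fintype.card (Fin n → Y) : ℝ)
      ≤ (max (Fintype.card S : ℝ) (Fintype.card Y)) ^ n := by
    intro n
    rw [Fintype.card_fun, Fintype.card_fin]
    push_cast
    gcongr
    exact le_max_right _ _
  unfold GAVWC.CaStr GAVWC.CmMis
  congr 1
  ext R
  exact ⟨fun h => GAVWC.achMMis_of_achAStr hA hcardS hcardS hcardY h, GAVWC.achAStr_of_achMMis⟩

end
end

section
/- For every real a with 0 < a < 1 there exists a GAVWC (𝒲ⁿ, 𝒱ⁿ)_{n≥1} such that |𝒲ⁿ| = 1 for all n, limsup_{n→∞} (1/n)·log₂ log₂ |𝒱ⁿ| = a, limsup_{n→∞} (1/n)·log₂ log₂ (1/vₙ) = 0 (where vₙ is the minimum positive value of Vⁿ(z|x) over Vⁿ ∈ 𝒱ⁿ, x, z), and C_{a-str}(𝒲ⁿ,𝒱ⁿ) = 1 while C_{m-mis}(𝒲ⁿ,𝒱ⁿ) = 1 − a; in particular the gap C_{a-str} − C_{m-mis} equals max{ limsup (1/n)·log₂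 log₂ |𝒲ⁿ| , limsup (1/n)·log₂ log₂ |𝒱ⁿ| }, so the upper bound on the gap is tight. -/
open scoped BigOperators

noncomputable section

/-- The number of main channels at blocklength `n`. -/
def GAVWC.cardW (C : GAVWC) (n : ℕ) : ℕ := @Fintype.card (C.SW n) (C.fSW n)

/-- The number of wiretap channels at blocklength `n`. -/
def GAVWC.cardV (C : GAVWC) (n : ℕ) : ℕ := @Fintype.card (C.SV n) (C.fSV n)

/-- `vₙ`: the minimum of `Vⁿ(z|x)` over all wiretap channels `Vⁿ ∈ 𝒱ⁿ` and all `x`, `z`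
with `Vⁿ(z|x) > 0`. -/
def GAVWC.vmin (C : GAVWC) (n : ℕ) : ℝ :=
  sInf {r : ℝ | 0 < r ∧ ∃ (s : C.SV n) (x : C.X n) (z : C.Z n), C.V n s x z = r}

/-- Double logarithm (base `2`), with the convention `log₂ log₂ 1 = 0`
(indeed `Real.logb 2 0 = 0` in Mathlib). -/
def loglog (x : ℝ) : ℝ := Real.logb 2 (Real.logb 2 x)

section SmallSet

open Filter Topology Finset

/-- The noiseless channel on `X`. -/
def noiseless (X : Type) [DecidableEq X] (x y : X) : ℝ := if x = y then 1 else 0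

/-- The channel reporting whether its input belongs to `S`. -/
def membership {X : Type} [DecidableEq X] (S : Finset X) (x : X) (z : Bool) : ℝ :=
  if z = decide (x ∈ S) then 1 else 0

/-- The encoder mapping `u` to the uniform distribution on the fibre of `ψ` over `u`, when all
fibres have `B` elements. -/
def fibreEncoder {X U : Type} [DecidableEq U] (ψ : X → U) (B : ℕ) (u : U) (x : X) : ℝ :=
  if ψ x = u then (B : ℝ)⁻¹ else 0

theorem isChannel_noiseless (X : Type) [Fintype X] [DecidableEq X] :
    IsChannel (noiseless X) := by
  intro x
  refine ⟨fun y => ?_, ?_⟩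
  · unfold noiseless; split_ifs <;> norm_num
  · simp [noiseless]

theorem isChannel_membership {X : Type} [DecidableEq X] (S : Finset X) :
    IsChannel (membership S) := by
  intro x
  refine ⟨fun y => ?_, ?_⟩
  · unfold membership; split_ifs <;> norm_num
  · simp [membership]

theorem IsProbDist.le_one {α : Type} [Fintype α] {p : α → ℝ} (hp : IsProbDist p) (x : α) :
    p x ≤ 1 :=
  hp.2 ▸ single_le_sum (fun i _ => hp.1 i) (mem_univ x)

theorem isProbDist_Zout {U X Z : Type} [Fintype X] [Fintype Z] {Φ : U → X → ℝ}
    {V : X → Z → ℝ} {u : U} (hΦ : IsProbDist (Φ u)) (hV : IsChannel V) :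
    IsProbDist (Zout Φ V u) := by
  refine ⟨fun z => sum_nonneg fun x _ => mul_nonneg (hΦ.1 x) ((hV x).1 z), ?_⟩
  simp only [Zout]
  rw [sum_comm]
  simp only [← mul_sum, (hV _).2, mul_one, hΦ.2]

theorem Zout_noiseless {U X : Type} [Fintype X] [DecidableEq X] (Φ : U → X → ℝ) (u : U) :
    Zout Φ (noiseless X) u = Φ u := by
  ext y; simp [Zout, noiseless]

theorem Zout_membership_true {U X : Type} [Fintype X] [DecidableEq X] (Φ : U → X → ℝ)
    (S : Finset X) (u : U) : Zout Φ (membership S) u true = ∑ x ∈ S, Φ u x := by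
  simp [Zout, membership, sum_ite_mem]

theorem mutualInfo_le_binEntropy {U : Type} [Fintype U] {p : U → ℝ} (hp : IsProbDist p)
    {q : U → Bool → ℝ} (hq : IsChannel q) :
    mutualInfo p q ≤ Real.binEntropy (∑ v, p v * q v true) := by
  have key : ∀ z u, p u * q u z * Real.log (q u z / ∑ v, p v * q v z) ≤
      p u * q u z * -Real.log (∑ v, p v * q v z) := by
    intro z u
    have h0 : 0 ≤ p u * q u z := mul_nonneg (hp.1 u) ((hq u).1 z)
    rcases h0.eq_or_lt with h | h
    · simp [← h]
    · have hq0 : 0 < q u z := pos_of_mul_pos_right h (hp.1 u)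
      have hQ : 0 < ∑ v, p v * q v z := h.trans_le <|
        single_le_sum (f := fun v => p v * q v z)
          (fun v _ => mul_nonneg (hp.1 v) ((hq v).1 z)) (mem_univ u)
      refine mul_le_mul_of_nonneg_left ?_ h0
      rw [Real.log_div hq0.ne' hQ.ne']
      linarith [Real.log_nonpos hq0.le ((hq u).le_one z)]
  have hsum : ∑ v, p v * q v false = 1 - ∑ v, p v * q v true := by
    rw [eq_sub_iff_add_eq, ← sum_add_distrib, ← hp.2]
    refine sum_congr rfl fun v _ => ?_
    have := (hq v).2
    rw [Fintype.sum_bool] at this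
    rw [← mul_add, add_comm, this, mul_one]
  calc mutualInfo p q ≤ ∑ u, ∑ z, p u * q u z * -Real.log (∑ v, p v * q v z) :=
        sum_le_sum fun u _ => sum_le_sum fun z _ => key z u
    _ = _ := by
        rw [sum_comm, Fintype.sum_bool, ← sum_mul, ← sum_mul, hsum,
          Real.binEntropy_eq_negMulLog_add_negMulLog_one_sub]
        simp only [Real.negMulLog]
        ring

theorem exists_mutualInfo_le {mu : ℝ} (hmu : 0 < mu) :
    ∃ η > 0, ∀ {U : Type} [Fintype U] {p : U → ℝ} {q : U → Bool → ℝ}, IsProbDist p →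
      IsChannel q → ∑ v, p v * q v true ≤ η → mutualInfo p q ≤ mu := by
  have h := (Real.binEntropy_continuous.tendsto 0).eventually
    (Iio_mem_nhds (by simpa using hmu : Real.binEntropy 0 < mu))
  obtain ⟨η, hη, hball⟩ := Metric.eventually_nhds_iff.1 h
  refine ⟨η / 2, by positivity, fun {U} _ {p q} hp hq hle => ?_⟩
  have h0 : 0 ≤ ∑ v, p v * q v true :=
    sum_nonneg fun v _ => mul_nonneg (hp.1 v) ((hq v).1 true)
  refine (mutualInfo_le_binEntropy hp hq).trans (hball ?_).le
  rw [Real.dist_eq, sub_zero, abs_of_nonneg h0]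
  linarith

/-- A variational lower bound for the mutual information. -/
theorem le_mutualInfo {U Z : Type} [Fintype U] [Fintype Z] {p : U → ℝ} (hp : IsProbDist p)
    {q : U → Z → ℝ} (hq : IsChannel q) {c : U → Z → ℝ} (hc : ∀ u z, 0 < c u z) :
    ∑ u, ∑ z, (p u * q u z * (1 + Real.log (c u z)) - c u z * p u * ∑ v, p v * q v z) ≤
      mutualInfo p q := by
  refine sum_le_sum fun u _ => sum_le_sum fun z _ => ?_
  have hterm : ∀ v, 0 ≤ p v * q v z := fun v => mul_nonneg (hp.1 v) ((hq v).1 z)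
  have hQ : 0 ≤ ∑ v, p v * q v z := sum_nonneg fun v _ => hterm v
  rcases (hterm u).eq_or_lt with h | h
  · rw [← h]
    have := mul_nonneg (mul_nonneg (hc u z).le (hp.1 u)) hQ
    linarith
  · have hq0 : 0 < q u z := pos_of_mul_pos_right h (hp.1 u)
    have hQ0 : 0 < ∑ v, p v * q v z := h.trans_le <|
      single_le_sum (f := fun v => p v * q v z) (fun v _ => hterm v) (mem_univ u)
    set Q := ∑ v, p v * q v z
    have hlog := Real.one_sub_inv_le_log_of_pos (div_pos (div_pos hq0 hQ0) (hc u z))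
    rw [Real.log_div (div_pos hq0 hQ0).ne' (hc u z).ne'] at hlog
    have := mul_le_mul_of_nonneg_left hlog h.le
    have e : p u * q u z * (1 - (q u z / Q / c u z)⁻¹) = p u * q u z - c u z * p u * Q := by
      field_simp
    rw [e] at this
    linarith

/-- Semantic security fails for an observer who tells two messages apart. -/
theorem exists_lt_mutualInfo {U : Type} [Fintype U] [DecidableEq U] {q : U → Bool → ℝ}
    (hq : IsChannel q) {u u' : U} (huu' : u ≠ u') (hu : 3 / 4 ≤ q u true)
    (hu' : q u' true ≤ 1 / 4) :
    ∃ p : U → ℝ, IsProbDist p ∧ Real.log (27 / 16) / 4 ≤ mutualInfo p q := by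
  let p : U → ℝ := fun v => (if v = u then 1 / 2 else 0) + if v = u' then 1 / 2 else 0
  have hp : IsProbDist p := by
    refine ⟨fun v => ?_, ?_⟩
    · dsimp only [p]; split_ifs <;> norm_num
    · simp only [p, sum_add_distrib, sum_ite_eq', mem_univ, if_true]; norm_num
  refine ⟨p, hp, le_trans ?_ (le_mutualInfo hp hq
    (c := fun v z => if z = decide (v = u) then 3 / 2 else 1 / 2)
    (fun v z => by split_ifs <;> norm_num))⟩
  have e := (hq u).2
  have e' := (hq u').2
  rw [Fintype.sum_bool] at e e'
  have h1 : Real.log (27 / 16) = 3 * Real.log (3 / 2) - Real.log 2 := by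
    rw [show (27 / 16 : ℝ) = (3 / 2) ^ 3 / 2 by norm_num, Real.log_div (by norm_num) (by norm_num),
      Real.log_pow]
    norm_num
  have h2 : Real.log (1 / 2) = -Real.log 2 := by rw [one_div, Real.log_inv]
  have h3 : 0 < Real.log (3 / 2) := Real.log_pos (by norm_num)
  have h4 : 0 < Real.log 2 := Real.log_pos (by norm_num)
  have hf : q u false = 1 - q u true := by linarith
  have hf' : q u' false = 1 - q u' true := by linarith
  simp only [p, add_mul, mul_add, ite_mul, mul_ite, zero_mul, mul_zero, sum_add_distrib,
    sum_sub_distrib, sum_ite_eq', mem_univ, if_true, Fintype.sum_bool, decide_true,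
    huu'.symm, decide_false, Bool.false_eq_true, Bool.true_eq_false, if_false, hf, hf', h1]
  rw [h2]
  nlinarith [mul_nonneg (sub_nonneg.2 hu) h3.le, mul_nonneg (sub_nonneg.2 hu) h4.le,
    mul_nonneg (sub_nonneg.2 hu') h3.le, mul_nonneg (sub_nonneg.2 hu') h4.le]

theorem exists_card_fibre_eq {X : Type} [Fintype X] {M B : ℕ} (h : Fintype.card X = M * B) :
    ∃ ψ : X → Fin M, ∀ u, #{x | ψ x = u} = B := by
  let e : X ≃ Fin M × Fin B := Fintype.equivOfCardEq (by simp [h])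
  have hinj : ∀ u, Function.Injective fun b => e.symm (u, b) := fun u b c hbc => by
    simpa using hbc
  refine ⟨fun x => (e x).1, fun u => ?_⟩
  have : ({x | (e x).1 = u} : Finset X) = (univ.map ⟨fun b => e.symm (u, b), hinj u⟩ : Finset X) := by
    ext x
    simp only [mem_filter, mem_univ, true_and, Finset.mem_map, Function.Embedding.coeFn_mk]
    refine ⟨fun hx => ⟨(e x).2, by rw [← hx]; simp⟩, ?_⟩
    rintro ⟨b, rfl⟩
    simp
  rw [this, card_map, card_univ, Fintype.card_fin]

section fibreEncoder

variable {X U : Type} [Fintype X] [DecidableEq U] {ψ : X → U} {B : ℕ}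

theorem isProbDist_fibreEncoder (hB : 0 < B) (hψ : ∀ u, #{x | ψ x = u} = B) (u : U) :
    IsProbDist (fibreEncoder ψ B u) := by
  refine ⟨fun x => ?_, ?_⟩
  · unfold fibreEncoder; split_ifs <;> positivity
  · simp only [fibreEncoder]
    rw [← sum_filter, sum_const, hψ, nsmul_eq_mul]
    exact mul_inv_cancel₀ (by positivity)

theorem errProb_fibreEncoder [DecidableEq X] (u : U) :
    errProb (noiseless X) (fibreEncoder ψ B) ψ u = 0 := by
  refine sum_eq_zero fun y _ => ?_
  rw [Zout_noiseless]
  unfold fibreEncoder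
  split_ifs <;> rfl

theorem Zout_fibreEncoder_le [DecidableEq X] (S : Finset X) (u : U) :
    Zout (fibreEncoder ψ B) (membership S) u true ≤ #S / B := by
  rw [Zout_membership_true, div_eq_mul_inv, ← nsmul_eq_mul]
  refine sum_le_card_nsmul _ _ _ fun x _ => ?_
  unfold fibreEncoder
  split_ifs
  · rfl
  · positivity

theorem sum_Zout_fibreEncoder [DecidableEq X] [Fintype U] (S : Finset X) :
    ∑ u, Zout (fibreEncoder ψ B) (membership S) u true = #S / B := by
  simp_rw [Zout_membership_true]
  rw [sum_comm]
  simp [fibreEncoder, div_eq_mul_inv]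

end fibreEncoder

theorem sum_success_eq {U X : Type} [Fintype X] [DecidableEq X] [DecidableEq U] {Φ : U → X → ℝ}
    {u : U} (hΦ : IsProbDist (Φ u)) (ψ : X → U) :
    ∑ x with ψ x = u, Φ u x = 1 - errProb (noiseless X) Φ ψ u := by
  rw [eq_sub_iff_add_eq, ← hΦ.2, ← sum_filter_add_sum_filter_not univ (fun x => ψ x = u)]
  congr 1
  rw [sum_filter, errProb, Zout_noiseless]

/-- A code for the noiseless channel with average error at most `lam` has at most
`|X| / (1 - lam)` messages. -/
theorem card_mul_one_sub_le {X : Type} [Fintype X] [DecidableEq X] {M : ℕ} (hM : 0 < M)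
    {Φ : Fin M → X → ℝ} (hΦ : ∀ u, IsProbDist (Φ u)) {ψ : X → Fin M} {lam : ℝ}
    (h : ∑ u, (M : ℝ)⁻¹ * errProb (noiseless X) Φ ψ u ≤ lam) :
    M * (1 - lam) ≤ Fintype.card X := by
  have h1 : ∑ u, ∑ x with ψ x = u, Φ u x ≤ Fintype.card X := by
    calc ∑ u, ∑ x with ψ x = u, Φ u x ≤ ∑ u, ∑ x with ψ x = u, (1 : ℝ) :=
          sum_le_sum fun u _ => sum_le_sum fun x _ => (hΦ u).le_one x
      _ = Fintype.card X := by
          rw [sum_fiberwise]; simp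
  simp_rw [sum_success_eq (hΦ _) ψ, sum_sub_distrib] at h1
  rw [← mul_sum, inv_mul_le_iff₀ (by positivity)] at h
  simp at h1
  linarith

/-- A code for the noiseless channel whose message set is too large has a message with a small
decoding set, which reveals that message. -/
theorem exists_membership_leak {X : Type} [Fintype X] [DecidableEq X] {M k : ℕ} (hM : 2 ≤ M)
    (hcard : Fintype.card X < M * k) {Φ : Fin M → X → ℝ} (hΦ : ∀ u, IsProbDist (Φ u))
    {ψ : X → Fin M} (h : ∀ u, errProb (noiseless X) Φ ψ u ≤ 1 / 4) :
    ∃ S : Finset X, #S ≤ k ∧ ∃ p : Fin M → ℝ, IsProbDist p ∧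
      Real.log (27 / 16) / 4 ≤ mutualInfo p (fun u => Zout Φ (membership S) u) := by
  obtain ⟨u, -, hu⟩ : ∃ u ∈ (univ : Finset (Fin M)), #{x | ψ x = u} < k :=
    exists_card_fiber_lt_of_card_lt_nsmul (by simpa using hcard)
  have : Nontrivial (Fin M) := Fin.nontrivial_iff_two_le.2 hM
  obtain ⟨u', hu'⟩ := exists_ne u
  refine ⟨({x | ψ x = u} : Finset X), hu.le, exists_lt_mutualInfo
    (fun v => isProbDist_Zout (hΦ v) (isChannel_membership _)) hu'.symm ?_ ?_⟩
  · rw [Zout_membership_true, sum_success_eq (hΦ u)]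
    linarith [h u]
  · rw [Zout_membership_true]
    have hsub : ∑ x with ψ x = u, Φ u' x ≤ ∑ x with ¬ ψ x = u', Φ u' x := by
      refine sum_le_sum_of_subset_of_nonneg (fun x hx => ?_) fun x _ _ => (hΦ u').1 x
      simp only [mem_filter, mem_univ, true_and] at hx ⊢
      rw [hx]; exact hu'.symm
    have := sum_filter_add_sum_filter_not univ (fun x => ψ x = u') (Φ u')
    rw [(hΦ u').2, sum_success_eq (hΦ u')] at this
    linarith [h u']

theorem card_finset_card_le_upper (X : Type) [Fintype X] [DecidableEq X] (k : ℕ) :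
    Fintype.card {S : Finset X // #S ≤ k} ≤ (Fintype.card X + 1) ^ k := by
  let f : (Fin k → Option X) → Finset X := fun g => {x | ∃ i, g i = some x}
  calc Fintype.card {S : Finset X // #S ≤ k}
      ≤ #(univ.image f) := by
        rw [Fintype.card_subtype]
        refine card_le_card fun S hS => ?_
        simp only [mem_filter, mem_univ, true_and] at hS
        refine mem_image.2 ⟨fun i => if h : (i : ℕ) < #S then some (S.equivFin.symm ⟨i, h⟩)
          else none, mem_univ _, ?_⟩
        ext x
        simp only [f, mem_filter, mem_univ, true_and]
        constructor
        · rintro ⟨i, hi⟩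
          split_ifs at hi with h
          rw [← Option.some.inj hi]
          exact (S.equivFin.symm ⟨i, h⟩).2
        · intro hx
          have hlt := (S.equivFin ⟨x, hx⟩).2
          exact ⟨⟨S.equivFin ⟨x, hx⟩, hlt.trans_le hS⟩, by simp [hlt]⟩
    _ ≤ Fintype.card (Fin k → Option X) := card_image_le
    _ = (Fintype.card X + 1) ^ k := by simp

theorem le_card_finset_card_le (X : Type) [Fintype X] [DecidableEq X] {k : ℕ}
    (hk : k ≤ Fintype.card X) : 2 ^ k ≤ Fintype.card {S : Finset X // #S ≤ k} := by
  obtain ⟨T, -, hT⟩ := exists_subset_card_eq (s := (univ : Finset X)) (by simpa using hk)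
  rw [← hT, ← card_powerset, Fintype.card_subtype]
  refine card_le_card fun S hS => ?_
  simpa using card_le_card (mem_powerset.1 hS)

/-- Binary words over a noiseless main channel, where the eavesdroppers observe whether the word
belongs to a set with at most `2 ^ ⌊n a⌋` elements. -/
def smallSetGAVWC (a : ℝ) : GAVWC where
  X n := Fin n → Bool
  Y n := Fin n → Bool
  Z _ := Bool
  SW _ := Unit
  SV n := {S : Finset (Fin n → Bool) // #S ≤ 2 ^ ⌊n * a⌋₊}
  fX _ := inferInstance
  fY _ := inferInstance
  fZ _ := inferInstance
  fSW _ := inferInstance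
  fSV _ := inferInstance
  neX _ := inferInstance
  neY _ := inferInstance
  neZ _ := inferInstance
  neSW _ := inferInstance
  neSV _ := ⟨⟨∅, by simp⟩⟩
  W n _ := noiseless (Fin n → Bool)
  V _ S := membership S.1
  chanW _ _ := isChannel_noiseless _
  chanV _ S := isChannel_membership S.1

namespace smallSetGAVWC

variable {a : ℝ}

theorem cardW_eq (n : ℕ) : (smallSetGAVWC a).cardW n = 1 := rfl

theorem floor_le (ha1 : a < 1) (n : ℕ) : ⌊n * a⌋₊ ≤ n :=
  Nat.floor_le_of_le (by nlinarith [Nat.cast_nonneg (α := ℝ) n])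

theorem floor_add_le (ha0 : 0 < a) (ha1 : a < 1) {j n : ℕ} (h : (j : ℝ) / (1 - a) < n) :
    ⌊n * a⌋₊ + j ≤ n := by
  rw [div_lt_iff₀ (by linarith)] at h
  have := Nat.floor_le (a := n * a) (by positivity)
  have : ((⌊n * a⌋₊ + j : ℕ) : ℝ) ≤ n := by push_cast; linarith
  exact_mod_cast this

theorem two_pow_le_cardV (ha1 : a < 1) (n : ℕ) :
    2 ^ 2 ^ ⌊n * a⌋₊ ≤ (smallSetGAVWC a).cardV n :=
  le_card_finset_card_le (Fin n → Bool) <| by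
    simpa using Nat.pow_le_pow_right two_pos (floor_le ha1 n)

theorem cardV_le (n : ℕ) : (smallSetGAVWC a).cardV n ≤ 2 ^ ((n + 1) * 2 ^ ⌊n * a⌋₊) := by
  refine (card_finset_card_le_upper (Fin n → Bool) _).trans ?_
  rw [pow_mul]
  refine Nat.pow_le_pow_left ?_ _
  simpa [pow_succ, mul_two] using Nat.one_le_two_pow (n := n)

theorem loglog_two_pow (m : ℕ) : loglog ((2 ^ m : ℕ) : ℝ) = Real.logb 2 m := by
  simp [loglog, Real.logb_pow]

theorem loglog_mono {x y : ℝ} (hx : 1 < x) (hxy : x ≤ y) : loglog x ≤ loglog y :=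
  Real.logb_le_logb_of_le one_lt_two (Real.logb_pos one_lt_two hx)
    (Real.logb_le_logb_of_le one_lt_two (by linarith) hxy)

theorem tendsto_floor (ha0 : 0 < a) :
    Tendsto (fun n : ℕ => (n : ℝ)⁻¹ * ⌊n * a⌋₊) atTop (𝓝 a) := by
  have := (tendsto_nat_floor_mul_div_atTop ha0.le).comp tendsto_natCast_atTop_atTop
  refine this.congr fun n => ?_
  simp [div_eq_inv_mul, mul_comm a]

theorem tendsto_inv_mul_logb :
    Tendsto (fun n : ℕ => (n : ℝ)⁻¹ * Real.logb 2 (n + 1)) atTop (𝓝 0) := by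
  have h := (Real.isLittleO_log_id_atTop.tendsto_div_nhds_zero.comp
    ((tendsto_atTop_add_const_right _ (1 : ℝ) tendsto_natCast_atTop_atTop)))
  have h' : Tendsto (fun n : ℕ => ((n : ℝ) + 1) / n) atTop (𝓝 1) := by
    have := (tendsto_inv_atTop_nhds_zero_nat (𝕜 := ℝ)).const_add 1
    rw [add_zero] at this
    refine this.congr' ?_
    filter_upwards [eventually_gt_atTop 0] with n hn
    field_simp
  have h2 := (h.mul h').mul_const (Real.log 2)⁻¹
  simp only [zero_mul] at h2
  refine h2.congr fun n => ?_
  have : (n : ℝ) + 1 ≠ 0 := by positivity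
  simp only [Function.comp, id, Real.logb]
  field_simp

theorem tendsto_loglog_cardV (ha0 : 0 < a) (ha1 : a < 1) :
    Tendsto (fun n : ℕ => (n : ℝ)⁻¹ * loglog ((smallSetGAVWC a).cardV n)) atTop (𝓝 a) := by
  have hup := tendsto_inv_mul_logb.add (tendsto_floor ha0)
  rw [zero_add] at hup
  have hone : ∀ n : ℕ, (1 : ℝ) < ((2 ^ 2 ^ ⌊n * a⌋₊ : ℕ) : ℝ) := fun n => by
    exact_mod_cast Nat.one_lt_two_pow (by positivity)
  refine tendsto_of_tendsto_of_tendsto_of_le_of_le (tendsto_floor ha0) hup (fun n => ?_)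
    fun n => ?_
  · refine mul_le_mul_of_nonneg_left ?_ (by positivity)
    have := loglog_mono (hone n) (Nat.cast_le.2 (two_pow_le_cardV ha1 n))
    rw [loglog_two_pow] at this
    simpa [Real.logb_pow] using this
  · have hle : loglog ((smallSetGAVWC a).cardV n) ≤ _ :=
      loglog_mono ((hone n).trans_le (Nat.cast_le.2 (two_pow_le_cardV ha1 n)))
        (Nat.cast_le.2 (cardV_le n))
    rw [loglog_two_pow] at hle
    push_cast at hle
    rw [Real.logb_mul (by positivity) (by positivity), Real.logb_pow, Real.logb_self_eq_one
      one_lt_two, mul_one] at hle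
    simp only [← mul_add]
    exact mul_le_mul_of_nonneg_left hle (by positivity)

theorem loglog_one : loglog 1 = 0 := by simp [loglog]

theorem vmin_eq (n : ℕ) : (smallSetGAVWC a).vmin n = 1 := by
  have : {r : ℝ | 0 < r ∧ ∃ (s : (smallSetGAVWC a).SV n) (x : (smallSetGAVWC a).X n)
      (z : (smallSetGAVWC a).Z n), (smallSetGAVWC a).V n s x z = r} = {1} := by
    ext r
    simp only [Set.mem_ofPred_eq, Set.mem_singleton_iff]
    constructor
    · rintro ⟨hr, s, x, z, rfl⟩
      change 0 < membership s.1 x z at hr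
      change membership s.1 x z = 1
      unfold membership at hr ⊢
      split_ifs at hr ⊢
      · rfl
      · exact absurd hr (lt_irrefl _)
    · rintro rfl
      refine ⟨one_pos, ⟨∅, by simp⟩, fun _ => true, false, ?_⟩
      change membership (∅ : Finset (Fin n → Bool)) (fun _ => true) false = 1
      simp [membership]
  exact (congrArg sInf this).trans (csInf_singleton 1)

theorem achAStr_iff {R : ℝ} : (smallSetGAVWC a).achAStr R ↔ 0 ≤ R ∧
    ∀ ε > (0 : ℝ), ∀ lam > (0 : ℝ), ∀ mu > (0 : ℝ), ∃ N : ℕ, ∀ n ≥ N,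
    ∃ (M : ℕ) (Φ : Fin M → (Fin n → Bool) → ℝ) (ψ : (Fin n → Bool) → Fin M),
      0 < M ∧ (∀ u, IsProbDist (Φ u)) ∧ (n : ℝ)⁻¹ * Real.logb 2 M > R - ε ∧
      (Unit → (∑ u, (M : ℝ)⁻¹ * errProb (noiseless _) Φ ψ u) ≤ lam) ∧
      (∀ S : {S : Finset (Fin n → Bool) // #S ≤ 2 ^ ⌊n * a⌋₊},
        mutualInfo (fun _ : Fin M => (M : ℝ)⁻¹) (fun u => Zout Φ (membership S.1) u) ≤ mu) :=
  Iff.rfl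

theorem achMMis_iff {R : ℝ} : (smallSetGAVWC a).achMMis R ↔ 0 ≤ R ∧
    ∀ ε > (0 : ℝ), ∀ lam > (0 : ℝ), ∀ mu > (0 : ℝ), ∃ N : ℕ, ∀ n ≥ N,
    ∃ (M : ℕ) (Φ : Fin M → (Fin n → Bool) → ℝ) (ψ : (Fin n → Bool) → Fin M),
      0 < M ∧ (∀ u, IsProbDist (Φ u)) ∧ (n : ℝ)⁻¹ * Real.logb 2 M > R - ε ∧
      (Unit → ∀ u, errProb (noiseless _) Φ ψ u ≤ lam) ∧
      (∀ S : {S : Finset (Fin n → Bool) // #S ≤ 2 ^ ⌊n * a⌋₊}, ∀ p : Fin M → ℝ, IsProbDist p →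
        mutualInfo p (fun u => Zout Φ (membership S.1) u) ≤ mu) :=
  Iff.rfl

theorem achAStr_one (ha0 : 0 < a) (ha1 : a < 1) : (smallSetGAVWC a).achAStr 1 := by
  refine achAStr_iff.2 ⟨zero_le_one, fun ε hε lam hlam mu hmu => ?_⟩
  obtain ⟨η, hη, hmi⟩ := exists_mutualInfo_le hmu
  obtain ⟨j, hj⟩ := exists_pow_lt_of_lt_one hη (one_half_lt_one (α := ℝ))
  obtain ⟨N, hN⟩ := exists_nat_gt ((j : ℝ) / (1 - a))
  refine ⟨N + 1, fun n hn => ?_⟩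
  have hn0 : (0 : ℝ) < n := by exact_mod_cast (by omega : 0 < n)
  obtain ⟨ψ, hψ⟩ := exists_card_fibre_eq (X := Fin n → Bool) (M := 2 ^ n) (B := 1) (by simp)
  have hΦ := isProbDist_fibreEncoder one_pos hψ
  refine ⟨2 ^ n, fibreEncoder ψ 1, ψ, by positivity, hΦ, ?_, fun _ => ?_, fun S => ?_⟩
  · push_cast
    rw [Real.logb_pow, Real.logb_self_eq_one one_lt_two, mul_one, inv_mul_cancel₀ hn0.ne']
    linarith
  · simp only [errProb_fibreEncoder, mul_zero, sum_const_zero]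
    exact hlam.le
  · refine hmi ⟨fun _ => by positivity, by simp⟩
      (fun u => isProbDist_Zout (hΦ u) (isChannel_membership _)) ?_
    rw [← mul_sum, sum_Zout_fibreEncoder]
    have hfl : ⌊n * a⌋₊ + j ≤ n :=
      floor_add_le ha0 ha1 (hN.trans_le (Nat.cast_le.2 (by omega)))
    have hS : (#S.1 : ℝ) ≤ 2 ^ ⌊n * a⌋₊ := by exact_mod_cast S.2
    have hpow : (2 : ℝ) ^ ⌊n * a⌋₊ * 2 ^ j ≤ 2 ^ n := by
      rw [← pow_add]; exact pow_le_pow_right₀ one_le_two hfl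
    refine le_trans ?_ hj.le
    push_cast
    rw [div_one, inv_mul_le_iff₀ (by positivity), one_div, inv_pow, ← div_eq_mul_inv,
      le_div_iff₀ (by positivity)]
    nlinarith [pow_pos (two_pos (α := ℝ)) j]

theorem le_one_of_achAStr {R : ℝ} (h : (smallSetGAVWC a).achAStr R) : R ≤ 1 := by
  obtain ⟨-, h⟩ := achAStr_iff.1 h
  by_contra! hR
  obtain ⟨N, hN⟩ := h ((R - 1) / 2) (by linarith) (1 / 2) (by norm_num) 1 one_pos
  obtain ⟨n₀, hn₀⟩ := exists_nat_gt (2 / (R - 1))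
  obtain ⟨M, Φ, ψ, hM, hΦ, hrate, herr, -⟩ := hN (N + n₀ + 1) (by omega)
  set n := N + n₀ + 1 with hn
  have hn0 : (0 : ℝ) < n := by positivity
  have hnR : 2 < n * (R - 1) := by
    rw [div_lt_iff₀ (by linarith)] at hn₀
    refine hn₀.trans_le (mul_le_mul_of_nonneg_right ?_ (by linarith))
    exact_mod_cast (by omega : n₀ ≤ n)
  have hM' : (M : ℝ) ≤ 2 ^ (n + 1) := by
    have := card_mul_one_sub_le hM hΦ (herr ())
    simp at this
    rw [pow_succ]
    linarith
  have hlog : Real.logb 2 M ≤ n + 1 := by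
    have := Real.logb_le_logb_of_le one_lt_two (by positivity) hM'
    rwa [Real.logb_pow, Real.logb_self_eq_one one_lt_two, mul_one, Nat.cast_succ] at this
  rw [gt_iff_lt, lt_inv_mul_iff₀ hn0] at hrate
  nlinarith

theorem achMMis_one_sub (ha0 : 0 < a) (ha1 : a < 1) : (smallSetGAVWC a).achMMis (1 - a) := by
  refine achMMis_iff.2 ⟨by linarith, fun ε hε lam hlam mu hmu => ?_⟩
  obtain ⟨η, hη, hmi⟩ := exists_mutualInfo_le hmu
  obtain ⟨j, hj⟩ := exists_pow_lt_of_lt_one hη (one_half_lt_one (α := ℝ))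
  obtain ⟨N, hN⟩ := exists_nat_gt ((j : ℝ) / (1 - a))
  obtain ⟨N', hN'⟩ := exists_nat_gt ((j : ℝ) / ε)
  refine ⟨N + N' + 1, fun n hn => ?_⟩
  have hn0 : (0 : ℝ) < n := by exact_mod_cast (by omega : 0 < n)
  have hfl : ⌊n * a⌋₊ + j ≤ n :=
    floor_add_le ha0 ha1 (hN.trans_le (Nat.cast_le.2 (by omega)))
  have hjε : (j : ℝ) < n * ε := by
    rw [div_lt_iff₀ hε] at hN'
    refine hN'.trans_le (mul_le_mul_of_nonneg_right ?_ hε.le)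
    exact_mod_cast (by omega : N' ≤ n)
  set m := ⌊n * a⌋₊ + j with hm
  obtain ⟨ψ, hψ⟩ := exists_card_fibre_eq (X := Fin n → Bool) (M := 2 ^ (n - m)) (B := 2 ^ m)
    (by rw [← pow_add]; simp [Nat.sub_add_cancel hfl])
  have hΦ := isProbDist_fibreEncoder (by positivity) hψ
  refine ⟨2 ^ (n - m), fibreEncoder ψ (2 ^ m), ψ, by positivity, hΦ, ?_, fun _ u => ?_,
    fun S p hp => ?_⟩
  · push_cast
    rw [Real.logb_pow, Real.logb_self_eq_one one_lt_two, mul_one, gt_iff_lt,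
      lt_inv_mul_iff₀ hn0, Nat.cast_sub hfl, hm, Nat.cast_add]
    have := Nat.floor_le (a := n * a) (by positivity)
    linarith
  · rw [errProb_fibreEncoder]
    exact hlam.le
  · refine hmi hp (fun u => isProbDist_Zout (hΦ u) (isChannel_membership _)) ?_
    have hS : (#S.1 : ℝ) ≤ 2 ^ ⌊n * a⌋₊ := by exact_mod_cast S.2
    calc ∑ v, p v * Zout (fibreEncoder ψ (2 ^ m)) (membership S.1) v true
        ≤ ∑ v, p v * (#S.1 / (2 ^ m : ℕ)) :=
          sum_le_sum fun v _ => mul_le_mul_of_nonneg_left (Zout_fibreEncoder_le _ _) (hp.1 v)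
      _ = #S.1 / (2 ^ m : ℕ) := by rw [← sum_mul, hp.2, one_mul]
      _ ≤ (1 / 2) ^ j := by
          rw [hm]
          push_cast
          rw [div_le_iff₀ (by positivity), pow_add]
          refine hS.trans (le_of_eq ?_)
          rw [mul_left_comm, ← mul_pow]
          simp
      _ ≤ η := hj.le

theorem le_one_sub_of_achMMis (ha1 : a < 1) {R : ℝ}
    (h : (smallSetGAVWC a).achMMis R) : R ≤ 1 - a := by
  obtain ⟨-, h⟩ := achMMis_iff.1 h
  by_contra! hR
  have hpos : 0 < Real.log (27 / 16) := Real.log_pos (by norm_num)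
  obtain ⟨N, hN⟩ := h ((R - (1 - a)) / 2) (by linarith) (1 / 4) (by norm_num)
    (Real.log (27 / 16) / 8) (by positivity)
  obtain ⟨n₀, hn₀⟩ := exists_nat_gt (2 / (R - (1 - a)))
  obtain ⟨M, Φ, ψ, hM, hΦ, hrate, herr, hsec⟩ := hN (N + n₀ + 1) (by omega)
  set n := N + n₀ + 1 with hn
  have hn0 : (0 : ℝ) < n := by positivity
  have hnR : 2 < n * (R - (1 - a)) := by
    rw [div_lt_iff₀ (by linarith)] at hn₀
    refine hn₀.trans_le (mul_le_mul_of_nonneg_right ?_ (by linarith))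
    exact_mod_cast (by omega : n₀ ≤ n)
  rw [gt_iff_lt, lt_inv_mul_iff₀ hn0] at hrate
  have hlog : n * (1 - a) + 1 < Real.logb 2 M := by nlinarith
  have hfl := floor_le ha1 n
  have hfl' : n * a < ⌊n * a⌋₊ + 1 := Nat.lt_floor_add_one _
  have hMlt : ((2 ^ (n - ⌊n * a⌋₊) : ℕ) : ℝ) < M := by
    rw [← Real.logb_lt_logb_iff one_lt_two (by positivity) (by positivity)]
    push_cast
    rw [Real.logb_pow, Real.logb_self_eq_one one_lt_two, mul_one, Nat.cast_sub hfl]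
    linarith
  have hMlt := Nat.cast_lt.1 hMlt
  have hM2 : 2 ≤ M := by have := Nat.one_le_two_pow (n := n - ⌊n * a⌋₊); omega
  obtain ⟨S, hS, p, hp, hle⟩ := exists_membership_leak (k := 2 ^ ⌊n * a⌋₊) hM2 (by
    have := Nat.mul_lt_mul_of_pos_right hMlt (pow_pos two_pos ⌊n * a⌋₊)
    rw [← pow_add, Nat.sub_add_cancel hfl] at this
    simpa using this) hΦ (herr ())
  have := hsec ⟨S, hS⟩ p hp
  linarith

theorem CaStr_eq (ha0 : 0 < a) (ha1 : a < 1) : (smallSetGAVWC a).CaStr = 1 :=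
  IsGreatest.csSup_eq ⟨achAStr_one ha0 ha1, fun _ => le_one_of_achAStr⟩

theorem CmMis_eq (ha0 : 0 < a) (ha1 : a < 1) : (smallSetGAVWC a).CmMis = 1 - a :=
  IsGreatest.csSup_eq ⟨achMMis_one_sub ha0 ha1, fun _ => le_one_sub_of_achMMis ha1⟩

end smallSetGAVWC

end SmallSet

/-- For every `a` with `0 < a < 1` there exists a GAVWC with a single main
channel at every blocklength, `limsup (1/n)·log₂ log₂ |𝒱ⁿ| = a`,
`limsup (1/n)·log₂ log₂ (1/vₙ) = 0`, `C_{a-str} = 1` and `C_{m-mis} = 1 − a`; in particular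
the capacity gap equals `max{ limsup (1/n)·log₂ log₂ |𝒲ⁿ| , limsup (1/n)·log₂ log₂ |𝒱ⁿ| }`,
so the upper bound on the gap is tight. -/
theorem gavwc_capacity_gap_tight (a : ℝ) (ha0 : 0 < a) (ha1 : a < 1) :
    ∃ C : GAVWC,
      (∀ n, C.cardW n = 1) ∧
      Filter.limsup (fun n : ℕ => (n : ℝ)⁻¹ * loglog (C.cardV n)) Filter.atTop = a ∧
      Filter.limsup (fun n : ℕ => (n : ℝ)⁻¹ * loglog (C.vmin n)⁻¹) Filter.atTop = 0 ∧
      C.CaStr = 1 ∧ C.CmMis = 1 - a ∧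
      C.CaStr - C.CmMis =
        max (Filter.limsup (fun n : ℕ => (n : ℝ)⁻¹ * loglog (C.cardW n)) Filter.atTop)
            (Filter.limsup (fun n : ℕ => (n : ℝ)⁻¹ * loglog (C.cardV n)) Filter.atTop) := by
  have hV := (smallSetGAVWC.tendsto_loglog_cardV ha0 ha1).limsup_eq
  have hA := smallSetGAVWC.CaStr_eq ha0 ha1
  have hM := smallSetGAVWC.CmMis_eq ha0 ha1
  refine ⟨smallSetGAVWC a, smallSetGAVWC.cardW_eq, hV, ?_, hA, hM, ?_⟩
  · simp [smallSetGAVWC.vmin_eq, smallSetGAVWC.loglog_one]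
  · rw [hV, hA, hM]
    simp [smallSetGAVWC.cardW_eq, smallSetGAVWC.loglog_one, ha0.le]


end
end
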